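/- For every p with 1 < p < 1/(1−γ₋) there exist a constant c > 0 and a threshold x₀ ∈ (0,1] such that for every x ∈ (0, x₀] one has ∫_{(0,1]} (α + 1/p − 1) x^{−α} dμ(α) ≥ c · ∫_{(0,1]} x^{−α} dμ(α). -/

import Mathlib

open MeasureTheory Real

/-- The map `a ↦ (a - d) * x ^ (-a)` is integrable on `(0,1]` for a finite measure. -/
theorem integrableOn_sub_mul_rpow_neg (μ : Measure ℝ) [IsFiniteMeasure μ] (d : ℝ) {x : ℝ}
    (hx : 0 < x) : IntegrableOn (fun a : ℝ => (a - d) * x ^ (-a)) (Set.Ioc 0 1) μ := by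
  have hc : Continuous fun a : ℝ => (a - d) * x ^ (-a) :=
    (continuous_id.sub continuous_const).mul
      (continuous_const.rpow continuous_neg fun _ => Or.inl hx.ne')
  exact (hc.continuousOn.integrableOn_compact isCompact_Icc).mono_set Set.Ioc_subset_Icc_self

/-- The map `a ↦ x ^ (-a)` is integrable on `(0,1]` for a finite measure. -/
theorem integrableOn_rpow_neg (μ : Measure ℝ) [IsFiniteMeasure μ] {x : ℝ}
    (hx : 0 < x) : IntegrableOn (fun a : ℝ => x ^ (-a)) (Set.Ioc 0 1) μ := by
  have hc : Continuous fun a : ℝ => x ^ (-a) :=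
    continuous_const.rpow continuous_neg fun _ => Or.inl hx.ne'
  exact (hc.continuousOn.integrableOn_compact isCompact_Icc).mono_set Set.Ioc_subset_Icc_self

/-- Pointwise lower bound for `(a - d) * x ^ (-a)`, with a gain for `a > γ`. -/
theorem indicator_sub_le_sub_mul_rpow_neg {γ d x a : ℝ} (hd : 0 ≤ d) (hdγ : d ≤ γ) (hx : 0 < x)
    (hx1 : x ≤ 1) (ha : a ∈ Set.Ioc (0 : ℝ) 1) :
    (Set.Ioc γ 1).indicator (fun _ => (γ - d) * x ^ (-γ)) a - d * x ^ (-d) ≤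
      (a - d) * x ^ (-a) := by
  have hxa : 0 < x ^ (-a) := rpow_pos_of_pos hx _
  have hxd : 0 ≤ d * x ^ (-d) := mul_nonneg hd (rpow_pos_of_pos hx _).le
  by_cases h : γ < a
  · rw [Set.indicator_of_mem (show a ∈ Set.Ioc γ 1 from ⟨h, ha.2⟩)]
    have h1 : x ^ (-γ) ≤ x ^ (-a) := rpow_le_rpow_of_exponent_ge hx hx1 (by linarith)
    have h2 : (γ - d) * x ^ (-γ) ≤ (a - d) * x ^ (-a) :=
      mul_le_mul (by linarith) h1 (rpow_pos_of_pos hx _).le (by linarith)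
    linarith
  · rw [Set.indicator_of_notMem (fun h' => h h'.1)]
    rcases le_total d a with hda | hda
    · have := mul_nonneg (sub_nonneg.2 hda) hxa.le
      linarith
    · have h1 : x ^ (-a) ≤ x ^ (-d) := rpow_le_rpow_of_exponent_ge hx hx1 (by linarith)
      have h2 : d * x ^ (-a) ≤ d * x ^ (-d) := mul_le_mul_of_nonneg_left h1 hd
      have h3 : 0 ≤ a * x ^ (-a) := mul_nonneg ha.1.le hxa.le
      linarith

/-- If `μ` charges `(γ,1]` and `0 ≤ d < γ`, then `∫ (a - d) x ^ (-a) dμ(a)` is nonnegative for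
small `x`. -/
theorem exists_setIntegral_sub_mul_rpow_neg_nonneg (μ : Measure ℝ) [IsFiniteMeasure μ] {γ d : ℝ}
    (hγμ : 0 < μ (Set.Ioc γ 1)) (hd : 0 ≤ d) (hdγ : d < γ) :
    ∃ x₀ ∈ Set.Ioc (0 : ℝ) 1, ∀ x ∈ Set.Ioc (0 : ℝ) x₀,
      0 ≤ ∫ a in Set.Ioc (0 : ℝ) 1, (a - d) * x ^ (-a) ∂μ := by
  have hm : 0 < μ.real (Set.Ioc γ 1) := ENNReal.toReal_pos hγμ.ne' (measure_ne_top _ _)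
  have hδ : 0 < γ - d := sub_pos.2 hdγ
  have hlim : Filter.Tendsto (fun x : ℝ => x ^ (γ - d) * (d * μ.real (Set.Ioc 0 1)))
      (nhdsWithin 0 (Set.Ioi 0)) (nhds 0) := by
    have h := ((continuousAt_rpow_const 0 (γ - d) (Or.inr hδ.le)).tendsto.mul_const
      (d * μ.real (Set.Ioc 0 1))).mono_left (nhdsWithin_le_nhds (s := Set.Ioi 0))
    simpa [zero_rpow hδ.ne'] using h
  obtain ⟨u, hu, hsub⟩ := mem_nhdsGT_iff_exists_Ioc_subset.1
    (hlim.eventually (eventually_le_nhds (mul_pos hδ hm)))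
  refine ⟨min u 1, ⟨lt_min hu one_pos, min_le_right _ _⟩, fun x hx => ?_⟩
  have hx0 : 0 < x := hx.1
  have hx1 : x ≤ 1 := hx.2.trans (min_le_right _ _)
  have hxu : x ^ (γ - d) * (d * μ.real (Set.Ioc 0 1)) ≤ (γ - d) * μ.real (Set.Ioc γ 1) :=
    hsub ⟨hx0, hx.2.trans (min_le_left _ _)⟩
  have hind : Integrable ((Set.Ioc γ 1).indicator fun _ => (γ - d) * x ^ (-γ))
      (μ.restrict (Set.Ioc 0 1)) := (integrable_const _).indicator measurableSet_Ioc
  have hmono := setIntegral_mono_on (hind.sub (integrable_const (d * x ^ (-d))))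
    (integrableOn_sub_mul_rpow_neg μ d hx0) measurableSet_Ioc
    fun a ha => indicator_sub_le_sub_mul_rpow_neg hd hdγ.le hx0 hx1 ha
  refine le_trans ?_ hmono
  have hinter : Set.Ioc (0 : ℝ) 1 ∩ Set.Ioc γ 1 = Set.Ioc γ 1 :=
    Set.inter_eq_right.2 (Set.Ioc_subset_Ioc_left (hd.trans hdγ.le))
  simp only [Pi.sub_apply]
  rw [integral_sub hind (integrable_const _), setIntegral_indicator measurableSet_Ioc, hinter,
    setIntegral_const, setIntegral_const, smul_eq_mul, smul_eq_mul]
  have hsplit : x ^ (-d) = x ^ (γ - d) * x ^ (-γ) := by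
    rw [← rpow_add hx0]; congr 1; ring
  have := mul_le_mul_of_nonneg_right hxu (rpow_pos_of_pos hx0 (-γ)).le
  rw [hsplit]
  linarith

/-- `μ` is a nonzero distributed-order measure supported in `(0,1]`: it has the form
`Σₙ qₙ δ_{αₙ} + w·(Lebesgue on (0,1))` with `0 < α₁ < ⋯ < α_M < 1`, `qₙ ≥ 0`, and a
nonnegative weight `w ∈ L¹((0,1))` (either part may vanish, but `μ ≠ 0`). -/
def IsDistOrderMeasure (μ : Measure ℝ) : Prop :=
  μ ≠ 0 ∧
  ∃ (M : ℕ) (α : Fin M → ℝ) (q : Fin M → ℝ) (w : ℝ → ℝ),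
    StrictMono α ∧ (∀ n, α n ∈ Set.Ioo (0:ℝ) 1) ∧ (∀ n, 0 ≤ q n) ∧
    (∀ x ∈ Set.Ioo (0:ℝ) 1, 0 ≤ w x) ∧
    MeasureTheory.IntegrableOn w (Set.Ioo 0 1) ∧
    μ = (∑ n, ENNReal.ofReal (q n) • MeasureTheory.Measure.dirac (α n)) +
        ((MeasureTheory.volume.restrict (Set.Ioo (0:ℝ) 1)).withDensity
          fun x => ENNReal.ofReal (w x))

/-- For every `p` with `1 < p < 1/(1−γ₋)` there exist a constant `c > 0` and a threshold
`x₀ ∈ (0,1]` such that for every `x ∈ (0,x₀]`,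
`∫_{(0,1]} (α + 1/p − 1) x^{−α} dμ(α) ≥ c · ∫_{(0,1]} x^{−α} dμ(α)`. -/
theorem statement12 (μ : Measure ℝ) [IsFiniteMeasure μ] (hμ : IsDistOrderMeasure μ)
    (γ : ℝ) (hγ : γ ∈ Set.Ioo (0:ℝ) 1) (hγμ : 0 < μ (Set.Ioc γ 1))
    (p : ℝ) (hp1 : 1 < p) (hp2 : p < 1 / (1 - γ)) :
    ∃ c : ℝ, 0 < c ∧ ∃ x₀ ∈ Set.Ioc (0:ℝ) 1, ∀ x ∈ Set.Ioc (0:ℝ) x₀,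
      c * ∫ a in Set.Ioc (0:ℝ) 1, x ^ (-a) ∂μ ≤
        ∫ a in Set.Ioc (0:ℝ) 1, (a + 1 / p - 1) * x ^ (-a) ∂μ := by
  have hγ1 : 0 < 1 - γ := sub_pos.2 hγ.2
  have hp0 : 0 < p := one_pos.trans hp1
  have hs0 : 1 / p < 1 := (div_lt_one hp0).2 hp1
  have hsγ : 1 - γ < 1 / p := (lt_one_div hp0 hγ1).1 hp2
  obtain ⟨x₀, hx₀, h⟩ := exists_setIntegral_sub_mul_rpow_neg_nonneg μ
    (d := (γ + (1 - 1 / p)) / 2) hγμ (by linarith [hγ.1]) (by linarith)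
  refine ⟨(γ - (1 - 1 / p)) / 2, by linarith, x₀, hx₀, fun x hx => ?_⟩
  rw [← sub_nonneg, ← integral_const_mul, ← integral_sub]
  · convert h x hx using 3
    ring
  · exact (integrableOn_sub_mul_rpow_neg μ (1 - 1 / p) hx.1).congr
      (Filter.Eventually.of_forall fun a => by ring)
  · exact (integrableOn_rpow_neg μ hx.1).const_mul _
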